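/- For every n ∈ ℕ, n ≥ 1, lim_{t→+∞} ∫_ℝ |x|^{2n} (2π V_{2,H}(t))^{−1/2} e^{−x²/(2V_{2,H}(t))} dx = (2 θ^{2H} H Γ(2H))ⁿ Γ((2n+1)/2)/√π; that is, the 2n-th absolute moment of a centered Gaussian random variable with variance V_{2,H}(t) converges, as t → +∞, to (2 θ^{2H} H Γ(2H))ⁿ Γ((2n+1)/2)/√π. -/

import Mathlib

open MeasureTheory Set Filter
open scoped Topology

/-- The incomplete integral `∫₀ʷ e^{c s} s^{p-1} ds`. -/
noncomputable def expPowIntegral (c p w : ℝ) : ℝ :=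
  ∫ s in (0:ℝ)..w, Real.exp (c * s) * s ^ (p - 1)

lemma intervalIntegrable_exp_mul_rpow (c : ℝ) {p : ℝ} (hp : 0 < p) (a b : ℝ) :
    IntervalIntegrable (fun s => Real.exp (c * s) * s ^ (p - 1)) volume a b :=
  (intervalIntegral.intervalIntegrable_rpow' (by linarith)).continuousOn_mul (by fun_prop)

lemma continuous_expPowIntegral (c : ℝ) {p : ℝ} (hp : 0 < p) :
    Continuous (expPowIntegral c p) :=
  intervalIntegral.continuous_primitive (intervalIntegrable_exp_mul_rpow c hp) 0

lemma hasDerivAt_expPowIntegral (c : ℝ) {p w : ℝ} (hp : 0 < p) (hw : 0 < w) :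
    HasDerivAt (expPowIntegral c p) (Real.exp (c * w) * w ^ (p - 1)) w := by
  refine intervalIntegral.integral_hasDerivAt_right (intervalIntegrable_exp_mul_rpow c hp 0 w) ?_ ?_
  · exact Measurable.stronglyMeasurable (by fun_prop) |>.stronglyMeasurableAtFilter
  · exact ContinuousAt.mul (by fun_prop) (Real.continuousAt_rpow_const _ _ (Or.inl hw.ne'))

lemma integral_exp_mul_expPowIntegral (b c : ℝ) {p t : ℝ} (hb : b ≠ 0) (hp : 0 < p) (ht : 0 ≤ t) :
    ∫ w in (0:ℝ)..t, Real.exp (b * w) * expPowIntegral c p w =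
      (Real.exp (b * t) * expPowIntegral c p t - expPowIntegral (b + c) p t) / b := by
  have hexp (x : ℝ) : HasDerivAt (fun w => Real.exp (b * w)) (Real.exp (b * x) * b) x := by
    simpa using ((hasDerivAt_id x).const_mul b).exp
  have key := intervalIntegral.integral_mul_deriv_eq_deriv_mul_of_hasDerivAt
    (u := expPowIntegral c p) (v := fun w => Real.exp (b * w))
    (u' := fun w => Real.exp (c * w) * w ^ (p - 1)) (v' := fun w => Real.exp (b * w) * b)
    (a := 0) (b := t) (continuous_expPowIntegral c hp).continuousOn (by fun_prop)
    (fun x hx => hasDerivAt_expPowIntegral c hp (by simpa [ht] using hx.1))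
    (fun x _ => hexp x) (intervalIntegrable_exp_mul_rpow c hp 0 t)
    (Continuous.intervalIntegrable (by fun_prop) _ _)
  have h1 : ∫ w in (0:ℝ)..t, expPowIntegral c p w * (Real.exp (b * w) * b) =
      b * ∫ w in (0:ℝ)..t, Real.exp (b * w) * expPowIntegral c p w := by
    rw [← intervalIntegral.integral_const_mul]
    congr 1; ext w; ring
  have h2 : ∫ w in (0:ℝ)..t, Real.exp (c * w) * w ^ (p - 1) * Real.exp (b * w) =
      expPowIntegral (b + c) p t := by
    unfold expPowIntegral
    congr 1; ext w
    rw [add_mul, Real.exp_add]; ring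
  have h0 : expPowIntegral c p 0 = 0 := by simp [expPowIntegral]
  rw [h1, h2, h0] at key
  rw [eq_div_iff hb]
  linarith

lemma integral_exp_mul_abs_sub_rpow (a : ℝ) {p t u : ℝ} (hp : 0 < p) (hu : 0 ≤ u) (hut : u ≤ t) :
    ∫ v in (0:ℝ)..t, Real.exp (a * (u + v)) * |u - v| ^ (p - 1) =
      Real.exp (2 * a * u) * (expPowIntegral (-a) p u + expPowIntegral a p (t - u)) := by
  have hl : EqOn (fun v => Real.exp (a * (u + v)) * |u - v| ^ (p - 1))
      (fun v => Real.exp (2 * a * u) * (Real.exp (-a * (u - v)) * (u - v) ^ (p - 1)))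
      (uIcc 0 u) := by
    intro v hv
    rw [uIcc_of_le hu] at hv
    simp only
    rw [abs_of_nonneg (by linarith [hv.2]), ← mul_assoc, ← Real.exp_add]
    ring_nf
  have hr : EqOn (fun v => Real.exp (a * (u + v)) * |u - v| ^ (p - 1))
      (fun v => Real.exp (2 * a * u) * (Real.exp (a * (v - u)) * (v - u) ^ (p - 1)))
      (uIcc u t) := by
    intro v hv
    rw [uIcc_of_le hut] at hv
    simp only
    rw [abs_sub_comm, abs_of_nonneg (by linarith [hv.1]), ← mul_assoc, ← Real.exp_add]
    ring_nf
  have il : IntervalIntegrable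
      (fun v => Real.exp (2 * a * u) * (Real.exp (-a * (u - v)) * (u - v) ^ (p - 1)))
      volume 0 u := by
    have := (intervalIntegrable_exp_mul_rpow (-a) hp u 0).comp_sub_left u
    simp only [sub_self, sub_zero] at this
    exact this.const_mul _
  have ir : IntervalIntegrable
      (fun v => Real.exp (2 * a * u) * (Real.exp (a * (v - u)) * (v - u) ^ (p - 1)))
      volume u t := by
    have := (intervalIntegrable_exp_mul_rpow a hp 0 (t - u)).comp_sub_right u
    simp only [zero_add, sub_add_cancel] at this
    exact this.const_mul _
  rw [← intervalIntegral.integral_add_adjacent_intervals (b := u)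
    (il.congr (hl.symm.mono uIoc_subset_uIcc))
    (ir.congr (hr.symm.mono uIoc_subset_uIcc)),
    intervalIntegral.integral_congr hl, intervalIntegral.integral_congr hr,
    intervalIntegral.integral_const_mul, intervalIntegral.integral_const_mul,
    intervalIntegral.integral_comp_sub_left (fun s => Real.exp (-a * s) * s ^ (p - 1)) u,
    intervalIntegral.integral_comp_sub_right (fun s => Real.exp (a * s) * s ^ (p - 1)) u]
  simp only [sub_self, sub_zero, expPowIntegral]
  ring

lemma integral_integral_exp_mul_abs_sub_rpow {a p t : ℝ} (ha : a ≠ 0) (hp : 0 < p) (ht : 0 ≤ t) :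
    ∫ u in (0:ℝ)..t, ∫ v in (0:ℝ)..t, Real.exp (a * (u + v)) * |u - v| ^ (p - 1) =
      (Real.exp (2 * a * t) * expPowIntegral (-a) p t - expPowIntegral a p t) / a := by
  have c1 := continuous_expPowIntegral (-a) hp
  have c2 := continuous_expPowIntegral a hp
  have h : EqOn (fun u => ∫ v in (0:ℝ)..t, Real.exp (a * (u + v)) * |u - v| ^ (p - 1))
      (fun u => Real.exp (2 * a * u) * expPowIntegral (-a) p u +
        Real.exp (2 * a * t) * (Real.exp (-(2 * a) * (t - u)) * expPowIntegral a p (t - u)))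
      (uIcc 0 t) := by
    intro u hu
    rw [uIcc_of_le ht] at hu
    simp only
    rw [integral_exp_mul_abs_sub_rpow a hp hu.1 hu.2, ← mul_assoc (Real.exp (2 * a * t)),
      ← Real.exp_add]
    ring_nf
  rw [intervalIntegral.integral_congr h, intervalIntegral.integral_add
    (Continuous.intervalIntegrable (by fun_prop) _ _)
    (Continuous.intervalIntegrable (by fun_prop) _ _),
    intervalIntegral.integral_const_mul,
    intervalIntegral.integral_comp_sub_left
      (fun s => Real.exp (-(2 * a) * s) * expPowIntegral a p s) t, sub_self, sub_zero,
    integral_exp_mul_expPowIntegral _ _ (by simpa using ha) hp ht,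
    integral_exp_mul_expPowIntegral _ _ (by simpa using ha) hp ht,
    show 2 * a + -a = a by ring, show -(2 * a) + a = -a by ring, neg_mul, Real.exp_neg]
  have := Real.exp_ne_zero (2 * a * t)
  field_simp
  ring

lemma tendsto_expPowIntegral_neg {a p : ℝ} (ha : 0 < a) (hp : 0 < p) :
    Tendsto (expPowIntegral (-a) p) atTop (𝓝 ((1 / a) ^ p * Real.Gamma p)) := by
  rw [← Real.integral_rpow_mul_exp_neg_mul_Ioi hp ha]
  have hi : IntegrableOn (fun s : ℝ => s ^ (p - 1) * Real.exp (-(a * s))) (Ioi 0) := by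
    simpa using integrableOn_rpow_mul_exp_neg_mul_rpow (p := 1) (s := p - 1) (by linarith)
      one_pos ha
  refine (intervalIntegral_tendsto_integral_Ioi 0 hi tendsto_id).congr fun t => ?_
  simp only [expPowIntegral, id, neg_mul, mul_comm (Real.exp _)]

lemma tendsto_exp_mul_expPowIntegral {a p : ℝ} (ha : 0 < a) (hp : 0 < p) :
    Tendsto (fun t => Real.exp (-(2 * a) * t) * expPowIntegral a p t) atTop (𝓝 0) := by
  have hlim := (tendsto_rpow_mul_exp_neg_mul_atTop_nhds_zero p a ha).div_const p
  rw [zero_div] at hlim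
  refine squeeze_zero' ?_ ?_ hlim
  · filter_upwards [eventually_ge_atTop 0] with t ht
    exact mul_nonneg (Real.exp_pos _).le (intervalIntegral.integral_nonneg ht fun s hs =>
      mul_nonneg (Real.exp_pos _).le (Real.rpow_nonneg hs.1 _))
  · filter_upwards [eventually_ge_atTop 0] with t ht
    have hle : expPowIntegral a p t ≤ Real.exp (a * t) * (t ^ p / p) := by
      have : ∫ s in (0:ℝ)..t, s ^ (p - 1) = t ^ p / p := by
        rw [integral_rpow (Or.inl (by linarith))]
        simp [Real.zero_rpow hp.ne']
      rw [← this, ← intervalIntegral.integral_const_mul]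
      refine intervalIntegral.integral_mono_on ht (intervalIntegrable_exp_mul_rpow a hp 0 t)
        ((intervalIntegral.intervalIntegrable_rpow' (by linarith)).const_mul _) fun s hs => ?_
      have := Real.rpow_nonneg hs.1 (p - 1)
      have := hs.2
      gcongr
    calc _ ≤ Real.exp (-(2 * a) * t) * (Real.exp (a * t) * (t ^ p / p)) := by gcongr
      _ = _ := by
        rw [← mul_assoc, ← Real.exp_add, show -(2 * a) * t + a * t = -a * t by ring]
        ring

lemma integral_abs_pow_mul_gaussian (n : ℕ) {σ : ℝ} (hσ : 0 < σ) :
    ∫ x : ℝ, |x| ^ (2*n) * (2 * Real.pi * σ) ^ (-(1:ℝ)/2) * Real.exp (-x^2 / (2 * σ)) =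
      (2 * σ) ^ n * Real.Gamma ((2*(n:ℝ)+1)/2) / Real.sqrt Real.pi := by
  have h2σ : 0 < 2 * σ := by positivity
  have h1 := integral_comp_abs (f := fun x : ℝ =>
    x ^ (2*n) * (2 * Real.pi * σ) ^ (-(1:ℝ)/2) * Real.exp (-x^2 / (2 * σ)))
  simp only [sq_abs] at h1
  have h2 := integral_rpow_mul_exp_neg_mul_rpow (p := 2) (q := ((2 * n : ℕ) : ℝ))
    (b := (2 * σ)⁻¹) two_pos (by have : (0:ℝ) ≤ ((2 * n : ℕ) : ℝ) := by positivity
                                 linarith) (by positivity)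
  have h3 : ∫ x in Ioi (0:ℝ), x ^ (2*n) * (2 * Real.pi * σ) ^ (-(1:ℝ)/2) *
      Real.exp (-x^2 / (2 * σ)) = (2 * Real.pi * σ) ^ (-(1:ℝ)/2) *
      ∫ x in Ioi (0:ℝ), x ^ ((2 * n : ℕ) : ℝ) * Real.exp (-(2 * σ)⁻¹ * x ^ (2:ℝ)) := by
    rw [← integral_const_mul]
    congr 1; ext x
    rw [Real.rpow_natCast, Real.rpow_two, show -x^2 / (2 * σ) = -(2 * σ)⁻¹ * x ^ 2 by
      rw [div_eq_mul_inv]; ring]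
    ring
  rw [h1, h3, h2]
  have e1 : (2 * Real.pi * σ) ^ (-(1:ℝ)/2) = (2 * σ) ^ (-(1:ℝ)/2) / Real.sqrt Real.pi := by
    rw [show 2 * Real.pi * σ = (2 * σ) * Real.pi by ring, Real.mul_rpow h2σ.le Real.pi_pos.le,
      Real.sqrt_eq_rpow, neg_div, Real.rpow_neg Real.pi_pos.le, ← div_eq_mul_inv]
  have e2 : ((2 * σ)⁻¹) ^ (-(((2 * n : ℕ) : ℝ) + 1) / 2) = (2 * σ) ^ n * (2 * σ) ^ ((1:ℝ)/2) := by
    rw [Real.inv_rpow h2σ.le, ← Real.rpow_neg h2σ.le, ← Real.rpow_natCast, ← Real.rpow_add h2σ]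
    congr 1; push_cast; ring
  have e3 : (2 * σ) ^ (-(1:ℝ)/2) * (2 * σ) ^ ((1:ℝ)/2) = 1 := by
    rw [← Real.rpow_add h2σ]; norm_num
  rw [e1, e2]
  push_cast
  linear_combination ((2 * σ) ^ n * Real.Gamma ((2*(n:ℝ)+1)/2) / Real.sqrt Real.pi) * e3

/-- The variance of the fractional Ornstein–Uhlenbeck process converges to its stationary value. -/
lemma tendsto_fractional_ou_variance {H θ : ℝ} (hH : 1 / 2 < H) (hθ : 0 < θ) :
    Tendsto (fun t : ℝ => H * (2*H - 1) * Real.exp (-2*t/θ) *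
      ∫ u in (0:ℝ)..t, ∫ v in (0:ℝ)..t, Real.exp ((u+v)/θ) * |u - v| ^ (2*H - 2))
      atTop (𝓝 (θ ^ (2*H) * H * Real.Gamma (2*H))) := by
  have hp : 0 < 2 * H - 1 := by linarith
  have ha : 0 < θ⁻¹ := inv_pos.mpr hθ
  have hlim := ((tendsto_expPowIntegral_neg ha hp).sub
    (tendsto_exp_mul_expPowIntegral ha hp)).const_mul (H * (2 * H - 1) * θ)
  have hval : H * (2 * H - 1) * θ * ((1 / θ⁻¹) ^ (2 * H - 1) * Real.Gamma (2 * H - 1) - 0) =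
      θ ^ (2*H) * H * Real.Gamma (2*H) := by
    have hG := Real.Gamma_add_one hp.ne'
    have hpow : θ ^ (2 * H) = θ ^ (2 * H - 1) * θ := by
      rw [← Real.rpow_add_one hθ.ne', sub_add_cancel]
    rw [sub_add_cancel] at hG
    rw [hG, hpow, one_div, inv_inv]
    ring
  rw [hval] at hlim
  refine hlim.congr' ?_
  filter_upwards [eventually_ge_atTop 0] with t ht
  have hI := integral_integral_exp_mul_abs_sub_rpow ha.ne' hp ht
  simp only [show 2 * H - 1 - 1 = 2 * H - 2 by ring, inv_mul_eq_div] at hI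
  rw [hI, show -2 * t / θ = -(2 * θ⁻¹ * t) by rw [div_eq_mul_inv]; ring, neg_mul, Real.exp_neg]
  have := Real.exp_ne_zero (2 * θ⁻¹ * t)
  field_simp

/-- The 2n-th absolute moment of a centered Gaussian with variance `V_{2,H}(t)` converges,
as `t → ∞`, to `(2 θ^{2H} H Γ(2H))ⁿ Γ((2n+1)/2)/√π`. -/
theorem stmt_5 (H θ : ℝ) (hH : H ∈ Set.Ioo (1/2 : ℝ) 1) (hθ : 0 < θ)
    (V : ℝ → ℝ)
    (hV : ∀ t : ℝ, V t = H * (2*H - 1) * Real.exp (-2*t/θ) *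
      ∫ u in (0:ℝ)..t, ∫ v in (0:ℝ)..t, Real.exp ((u+v)/θ) * |u - v| ^ (2*H - 2))
    (n : ℕ) (hn : 1 ≤ n) :
    Tendsto (fun t => ∫ x : ℝ,
        |x| ^ (2*n) * (2 * Real.pi * V t) ^ (-(1:ℝ)/2) * Real.exp (-x^2 / (2 * V t)))
      atTop
      (𝓝 ((2 * θ ^ (2*H) * H * Real.Gamma (2*H)) ^ n *
        Real.Gamma ((2*(n:ℝ)+1)/2) / Real.sqrt Real.pi)) := by
  have hlim := tendsto_fractional_ou_variance hH.1 hθ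
  rw [← funext hV] at hlim
  have hpos : 0 < θ ^ (2*H) * H * Real.Gamma (2*H) := by
    have hH0 : 0 < H := by linarith [hH.1]
    have := Real.Gamma_pos_of_pos (show 0 < 2 * H by linarith)
    positivity
  have hm := (((hlim.const_mul 2).pow n).mul_const (Real.Gamma ((2*(n:ℝ)+1)/2))).div_const
    (Real.sqrt Real.pi)
  simp only [← mul_assoc] at hm
  refine hm.congr' ?_
  filter_upwards [hlim.eventually_const_lt hpos] with t ht
  exact (integral_abs_pow_mul_gaussian n ht).symm
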